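/- Let p ∈ (0,1), let A be a random L×M real matrix with i.i.d. Bernoulli–Gaussian entries of parameter p with columns A_1,…,A_M ∈ ℝ^L, and let z ∈ ℝ^L be a fixed vector with ‖z‖₂ = 1. Then for every ε > 0, ℙ( Σ_{i=1}^M |⟨A_i, z⟩| ≤ M·p·(√(2/π) − ε) ) ≤ 2·exp( − M·p·ε² / (2 + √2·ε) ). -/

import Mathlib

open MeasureTheory Finset
open scoped ENNReal

noncomputable section

/-- The Bernoulli–Gaussian measure `ν_p = (1−p)·δ₀ + p·N(0,1)` on `ℝ`. -/
def bernoulliGaussian (p : ℝ) : Measure ℝ :=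
  (1 - p).toNNReal • Measure.dirac (0 : ℝ)
    + p.toNNReal • ProbabilityTheory.gaussianReal 0 1

instance (p : ℝ) : IsFiniteMeasure (bernoulliGaussian p) := by
  unfold bernoulliGaussian; infer_instance

section Helpers

open ProbabilityTheory
open scoped NNReal

instance isProbabilityMeasure_bernoulliGaussian (p : Set.Icc (0 : ℝ) 1) :
    IsProbabilityMeasure (bernoulliGaussian p) := by
  constructor
  have h : (1 - (p : ℝ)).toNNReal + (p : ℝ).toNNReal = 1 := by
    rw [← Real.toNNReal_add (by linarith [p.2.2]) p.2.1]
    simp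
  simpa [bernoulliGaussian] using congrArg ((↑) : ℝ≥0 → ℝ≥0∞) h

lemma lintegral_bernoulliGaussian (p : ℝ) {f : ℝ → ℝ≥0∞} :
    ∫⁻ x, f x ∂bernoulliGaussian p
      = ENNReal.ofReal (1 - p) * f 0 + ENNReal.ofReal p * ∫⁻ x, f x ∂gaussianReal 0 1 := by
  simp only [bernoulliGaussian, lintegral_add_measure, lintegral_smul_measure, lintegral_dirac]
  rfl

lemma lintegral_gaussianReal_add_mul {f : ℝ → ℝ≥0∞} (hf : Measurable f) (v : ℝ≥0) (c : ℝ) :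
    ∫⁻ a, ∫⁻ x, f (x + c * a) ∂gaussianReal 0 v ∂gaussianReal 0 1
      = ∫⁻ x, f x ∂gaussianReal 0 (v + .mk (c ^ 2) (sq_nonneg c)) := by
  have h := gaussianReal_conv_gaussianReal (m₁ := 0) (m₂ := 0) (v₁ := v)
    (v₂ := .mk (c ^ 2) (sq_nonneg c))
  rw [add_zero] at h
  have h2 := gaussianReal_map_const_mul (μ := 0) (v := 1) c
  rw [mul_zero, mul_one] at h2
  rw [← h, Measure.lintegral_conv hf, lintegral_lintegral_swap (by fun_prop), ← h2]
  refine lintegral_congr fun x => ?_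
  rw [lintegral_map (by fun_prop) (by fun_prop)]

/-- If the Gaussian averages of `f` are bounded by an affine function of the variance, then so are
its averages under the law of a Gaussian plus an independent weighted sum of Bernoulli–Gaussian
variables. -/
lemma lintegral_pi_bernoulliGaussian_add_gaussianReal_le (p : Set.Icc (0 : ℝ) 1)
    {f : ℝ → ℝ≥0∞} (hf : Measurable f) {c : ℝ}
    (hc : ∀ v : ℝ, 0 ≤ v → v ≤ 1 → 0 ≤ 1 - c * v)
    (h : ∀ v : ℝ≥0, v ≤ 1 → ∫⁻ x, f x ∂gaussianReal 0 v ≤ ENNReal.ofReal (1 - c * v)) :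
    ∀ (n : ℕ) (z : Fin n → ℝ) (v : ℝ≥0), v + ∑ l, z l ^ 2 ≤ 1 →
      ∫⁻ ω, ∫⁻ x, f (x + ∑ l, ω l * z l) ∂gaussianReal 0 v
          ∂Measure.pi (fun _ : Fin n => bernoulliGaussian p)
        ≤ ENNReal.ofReal (1 - c * (v + p * ∑ l, z l ^ 2)) := by
  have hp0 := p.2.1
  have hp1 := p.2.2
  intro n
  induction n with
  | zero =>
    intro z v hv
    have : (v : ℝ) ≤ 1 := by simpa using hv
    simpa using h v (by exact_mod_cast this)
  | succ n ih =>
    intro z v hv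
    rw [Fin.sum_univ_succ] at hv ⊢
    have hs : 0 ≤ ∑ l : Fin n, z l.succ ^ 2 := Finset.sum_nonneg fun _ _ => sq_nonneg _
    have hz0 := sq_nonneg (z 0)
    have hv0 := v.2
    set w : ℝ≥0 := v + .mk (z 0 ^ 2) (sq_nonneg _) with hw
    have hw' : (w : ℝ) = v + z 0 ^ 2 := by simp [hw]
    have ih1 := ih (fun l => z l.succ) v (by linarith)
    have ih2 := ih (fun l => z l.succ) w (by rw [hw']; linarith)
    rw [hw'] at ih2
    rw [← (measurePreserving_piFinSuccAbove (fun _ => bernoulliGaussian (p : ℝ)) 0).symm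
      |>.lintegral_comp_emb (MeasurableEquiv.measurableEmbedding _)]
    simp only [MeasurableEquiv.piFinSuccAbove_symm_apply, Fin.sum_univ_succ,
      Fin.insertNthEquiv, Fin.insertNth_zero', Equiv.coe_fn_mk, Fin.cons_zero, Fin.cons_succ]
    have hG : Measurable fun y : ℝ × (Fin n → ℝ) =>
        ∫⁻ x, f (x + (y.1 * z 0 + ∑ l : Fin n, y.2 l * z l.succ)) ∂gaussianReal 0 v :=
      Measurable.lintegral_prod_right (by fun_prop)
    rw [lintegral_prod _ hG.aemeasurable]
    rw [lintegral_bernoulliGaussian]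
    have gaussian_part : ∫⁻ a, ∫⁻ ω, ∫⁻ x, f (x + (a * z 0 + ∑ l : Fin n, ω l * z l.succ)) ∂gaussianReal 0 v
          ∂Measure.pi (fun _ : Fin n => bernoulliGaussian (p : ℝ)) ∂gaussianReal 0 1
        = ∫⁻ ω, ∫⁻ x, f (x + ∑ l : Fin n, ω l * z l.succ) ∂gaussianReal 0 w
          ∂Measure.pi (fun _ : Fin n => bernoulliGaussian (p : ℝ)) := by
      rw [lintegral_lintegral_swap hG.aemeasurable]
      refine lintegral_congr fun ω => ?_
      rw [← lintegral_gaussianReal_add_mul (f := fun y => f (y + ∑ l : Fin n, ω l * z l.succ))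
        (by fun_prop)]
      simp only [add_assoc, mul_comm]
    rw [gaussian_part]
    simp only [zero_mul, zero_add]
    have b1 : 0 ≤ 1 - c * (v + p * ∑ l : Fin n, z l.succ ^ 2) :=
      hc _ (by positivity) (by nlinarith)
    have b2 : 0 ≤ 1 - c * (v + z 0 ^ 2 + p * ∑ l : Fin n, z l.succ ^ 2) :=
      hc _ (by positivity) (by nlinarith)
    refine (add_le_add (mul_le_mul_right ih1 _) (mul_le_mul_right ih2 _)).trans_eq ?_
    rw [← ENNReal.ofReal_mul (by linarith), ← ENNReal.ofReal_mul hp0,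
      ← ENNReal.ofReal_add (mul_nonneg (by linarith) b1) (mul_nonneg hp0 b2)]
    congr 1
    ring

lemma integral_abs_gaussianReal : ∫ x, |x| ∂gaussianReal 0 1 = Real.sqrt (2 / Real.pi) := by
  rw [integral_gaussianReal_eq_integral_smul one_ne_zero]
  have h1 := integral_comp_abs (f := fun x => gaussianPDFReal 0 1 x * x)
  have h2 : ∀ x : ℝ, gaussianPDFReal 0 1 |x| = gaussianPDFReal 0 1 x := by
    intro x; simp [gaussianPDFReal]
  simp only [h2] at h1
  simp only [smul_eq_mul]
  rw [h1]
  have h3 := integral_rpow_mul_exp_neg_mul_rpow (p := 2) (q := 1) (b := 1 / 2) (by norm_num)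
    (by norm_num) (by norm_num)
  have h4 : ∫ x in Set.Ioi (0 : ℝ), gaussianPDFReal 0 1 x * x
      = (√(2 * Real.pi))⁻¹ *
        ∫ x in Set.Ioi (0 : ℝ), x ^ (1 : ℝ) * Real.exp (-(1 / 2) * x ^ (2 : ℝ)) := by
    rw [← integral_const_mul]
    congr 1
    ext x
    simp only [gaussianPDFReal, Real.rpow_one, Real.rpow_two]
    simp
    ring_nf
  rw [h4, h3]
  have h5 : ((1 / 2 : ℝ)) ^ (-(1 + 1) / 2 : ℝ) = 2 := by
    rw [show (-(1 + 1) / 2 : ℝ) = -1 by norm_num, Real.rpow_neg_one]; norm_num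
  rw [h5, show ((1 + 1) / 2 : ℝ) = 1 by norm_num, Real.Gamma_one,
    Real.sqrt_div (by norm_num), Real.sqrt_mul (by norm_num)]
  have h6 : √(2 : ℝ) ^ 2 = 2 := Real.sq_sqrt (by norm_num)
  have h7 : √(2 : ℝ) ≠ 0 := by positivity
  have h8 : √Real.pi ≠ 0 := by positivity
  field_simp
  linarith

lemma integral_sq_gaussianReal (v : ℝ≥0) : ∫ x, x ^ 2 ∂gaussianReal 0 v = v := by
  have h := variance_fun_id_gaussianReal (μ := 0) (v := v)
  rwa [variance_of_integral_eq_zero (by fun_prop) (by simp)] at h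

lemma exp_neg_le_quadratic {x : ℝ} (hx : 0 ≤ x) : Real.exp (-x) ≤ 1 - x + x ^ 2 / 2 := by
  have h := Real.quadratic_le_exp_of_nonneg hx
  have h1 : Real.exp (-x) * Real.exp x = 1 := by rw [← Real.exp_add]; simp
  have h2 := Real.exp_pos (-x)
  have h3 : Real.exp (-x) * (1 + x + x ^ 2 / 2) ≤ 1 :=
    (mul_le_mul_of_nonneg_left h h2.le).trans_eq h1
  have h4 : 0 < 1 + x + x ^ 2 / 2 := by positivity
  refine le_of_mul_le_mul_right (h3.trans ?_) h4
  nlinarith [sq_nonneg (x ^ 2)]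

/-- Second-order bound for the Laplace transform of the modulus of a Gaussian variable. -/
lemma integral_exp_neg_mul_abs_gaussianReal_le {t : ℝ} (ht : 0 ≤ t) {v : ℝ≥0} (hv : v ≤ 1) :
    ∫ x, Real.exp (-(t * |x|)) ∂gaussianReal 0 v
      ≤ 1 - (t * Real.sqrt (2 / Real.pi) - t ^ 2 / 2) * v := by
  have hv1 : (v : ℝ) ≤ 1 := by exact_mod_cast hv
  have iabs : Integrable (fun x : ℝ => |x|) (gaussianReal 0 v) :=
    ((memLp_id_gaussianReal 1).integrable (by simp)).abs
  have isq : Integrable (fun x : ℝ => x ^ 2) (gaussianReal 0 v) :=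
    (memLp_id_gaussianReal 2).integrable_sq
  have habs : ∫ x, |x| ∂gaussianReal 0 v = √v * Real.sqrt (2 / Real.pi) := by
    have h2 := gaussianReal_map_const_mul (μ := 0) (v := 1) (√(v : ℝ))
    have h3 : NNReal.mk (√(v : ℝ) ^ 2) (sq_nonneg _) = v := by
      ext; simp
    rw [mul_zero, mul_one, h3] at h2
    rw [← h2, integral_map (by fun_prop) (by fun_prop)]
    simp only [abs_mul, abs_of_nonneg (Real.sqrt_nonneg _)]
    rw [integral_const_mul, integral_abs_gaussianReal]
  have hsq : (v : ℝ) ≤ √v := by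
    refine Real.le_sqrt_of_sq_le ?_
    nlinarith [v.2]
  calc ∫ x, Real.exp (-(t * |x|)) ∂gaussianReal 0 v
      ≤ ∫ x, (1 - t * |x| + t ^ 2 / 2 * x ^ 2) ∂gaussianReal 0 v := by
        refine integral_mono_of_nonneg (ae_of_all _ fun x => (Real.exp_pos _).le)
          (((integrable_const _).sub (iabs.const_mul t)).add (isq.const_mul _))
          (ae_of_all _ fun x => ?_)
        have := exp_neg_le_quadratic (mul_nonneg ht (abs_nonneg x))
        rw [mul_pow, sq_abs] at this
        simp only
        linarith
    _ = 1 - t * (√v * Real.sqrt (2 / Real.pi)) + t ^ 2 / 2 * v := by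
        have i1 : Integrable (fun x : ℝ => 1 - t * |x|) (gaussianReal 0 v) :=
          (integrable_const _).sub (iabs.const_mul t)
        rw [integral_add i1 (isq.const_mul _),
          integral_sub (integrable_const _) (iabs.const_mul t), integral_const_mul,
          integral_const_mul, habs, integral_sq_gaussianReal]
        simp
    _ ≤ _ := by
        have := mul_le_mul_of_nonneg_left hsq
          (mul_nonneg ht (Real.sqrt_nonneg (2 / Real.pi)))
        linarith

lemma lintegral_exp_neg_mul_abs_sum_le (p : Set.Icc (0 : ℝ) 1) {t : ℝ} (ht : 0 ≤ t) {n : ℕ}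
    {z : Fin n → ℝ} (hz : ∑ l, z l ^ 2 = 1) :
    ∫⁻ ω, ENNReal.ofReal (Real.exp (-(t * |∑ l, ω l * z l|)))
        ∂Measure.pi (fun _ : Fin n => bernoulliGaussian p)
      ≤ ENNReal.ofReal (Real.exp (-(p * (t * Real.sqrt (2 / Real.pi) - t ^ 2 / 2)))) := by
  set c := t * Real.sqrt (2 / Real.pi) - t ^ 2 / 2
  have key := lintegral_pi_bernoulliGaussian_add_gaussianReal_le p
    (f := fun x => ENNReal.ofReal (Real.exp (-(t * |x|)))) (by fun_prop) (c := c)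
    (fun v hv0 hv1 => (integral_nonneg fun x => (Real.exp_pos _).le).trans
      (integral_exp_neg_mul_abs_gaussianReal_le ht (v := ⟨v, hv0⟩) hv1))
    (fun v hv => by
      rw [← ofReal_integral_eq_lintegral_ofReal _ (ae_of_all _ fun x => (Real.exp_pos _).le)]
      · exact ENNReal.ofReal_le_ofReal (integral_exp_neg_mul_abs_gaussianReal_le ht hv)
      · refine Integrable.of_bound (by fun_prop) 1 (ae_of_all _ fun x => ?_)
        rw [Real.norm_eq_abs, Real.abs_exp, Real.exp_le_one_iff]
        have := mul_nonneg ht (abs_nonneg x)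
        linarith)
    n z 0 (by simp [hz])
  simp only [gaussianReal_zero_var, lintegral_dirac, zero_add, hz] at key
  refine key.trans (ENNReal.ofReal_le_ofReal ?_)
  have := Real.add_one_le_exp (-(p * c))
  simp only [NNReal.coe_zero, zero_add, mul_one]
  linarith

lemma measurePreserving_uncurry_swap {ι κ α : Type*} [Fintype ι] [Fintype κ] [MeasurableSpace α]
    (μ : Measure α) [SigmaFinite μ] :
    MeasurePreserving (fun (η : κ → ι → α) (x : ι × κ) => η x.2 x.1)
      (Measure.pi fun _ => Measure.pi fun _ => μ) (Measure.pi fun _ => μ) := by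
  have hm : Measurable (fun (η : κ → ι → α) (x : ι × κ) => η x.2 x.1) := by fun_prop
  refine ⟨hm, (Measure.pi_eq fun s hs => ?_).symm⟩
  rw [Measure.map_apply hm (MeasurableSet.univ_pi hs)]
  have : (fun (η : κ → ι → α) (x : ι × κ) => η x.2 x.1) ⁻¹' Set.univ.pi s
      = Set.univ.pi fun k => Set.univ.pi fun i => s (i, k) := by
    ext η
    simp only [Set.mem_preimage, Set.mem_univ_pi, Prod.forall]
    exact forall_comm
  rw [this, Measure.pi_pi]
  simp only [Measure.pi_pi]
  rw [Fintype.prod_prod_type_right]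

lemma lintegral_pi_prod_eq_pow {ι α : Type*} [Fintype ι] [MeasurableSpace α]
    (μ : Measure α) [IsProbabilityMeasure μ] {f : α → ℝ≥0∞} (hf : Measurable f) :
    ∫⁻ η, ∏ i, f (η i) ∂Measure.pi (fun _ : ι => μ) = (∫⁻ x, f x ∂μ) ^ Fintype.card ι := by
  rw [lintegral_prod_eq_prod_lintegral_of_indepFun Finset.univ (fun i (η : ι → α) => f (η i))
    (iIndepFun_pi fun _ => hf.aemeasurable) (fun i => hf.comp (measurable_pi_apply i))]
  simp_rw [fun i => (measurePreserving_eval (fun _ : ι => μ) i).lintegral_comp hf]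
  simp

end Helpers

/-- **Lemma (lower bound for ‖Aᵀz‖₁).** If `A` is a random `L×M` matrix with i.i.d.
Bernoulli–Gaussian entries of parameter `p` and columns `A_1,…,A_M`, and `z ∈ ℝ^L` is a
fixed unit vector, then for `ε > 0`,
`ℙ(Σᵢ |⟨Aᵢ,z⟩| ≤ Mp(√(2/π)−ε)) ≤ 2·exp(−Mpε²/(2+√2·ε))`. -/
theorem stmt16 (p : ℝ) (hp0 : 0 < p) (hp1 : p < 1) (L M : ℕ) (hL : 0 < L) (hM : 0 < M)
    (z : Fin L → ℝ) (hz : Real.sqrt (∑ l, z l ^ 2) = 1)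
    (ε : ℝ) (hε : 0 < ε) :
    Measure.pi (fun _ : Fin L × Fin M => bernoulliGaussian p)
      {ω | (∑ i, |∑ l, ω (l, i) * z l|) ≤ M * p * (Real.sqrt (2 / Real.pi) - ε)}
      ≤ ENNReal.ofReal (2 * Real.exp (-(M * p * ε ^ 2) / (2 + Real.sqrt 2 * ε))) := by
  have hz1 : ∑ l, z l ^ 2 = 1 := by
    rwa [Real.sqrt_eq_one] at hz
  set q : Set.Icc (0 : ℝ) 1 := ⟨p, hp0.le, hp1.le⟩
  have : IsProbabilityMeasure (bernoulliGaussian p) := isProbabilityMeasure_bernoulliGaussian q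
  set τ := M * p * (Real.sqrt (2 / Real.pi) - ε) with hτ
  set Y : (Fin L → ℝ) → ℝ≥0∞ :=
    fun ω => ENNReal.ofReal (Real.exp (-(ε * |∑ l, ω l * z l|)))
  have hYm : Measurable Y := by fun_prop
  have hpre := measurePreserving_uncurry_swap (ι := Fin L) (κ := Fin M) (bernoulliGaussian p)
  rw [← hpre.measure_preimage (measurableSet_le (by fun_prop) (by fun_prop)).nullMeasurableSet]
  have hsub : (fun (η : Fin M → Fin L → ℝ) (x : Fin L × Fin M) => η x.2 x.1) ⁻¹'
        {ω | (∑ i, |∑ l, ω (l, i) * z l|) ≤ τ}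
      ⊆ {η | ENNReal.ofReal (Real.exp (-(ε * τ))) ≤ ∏ i, Y (η i)} := by
    intro η hη
    simp only [Set.mem_preimage, Set.mem_ofPred_eq] at hη ⊢
    rw [← ENNReal.ofReal_prod_of_nonneg fun _ _ => (Real.exp_pos _).le, ← Real.exp_sum,
      Finset.sum_neg_distrib, ← Finset.mul_sum]
    gcongr
  have hprod : ∫⁻ η, ∏ i, Y (η i)
        ∂Measure.pi (fun _ : Fin M => Measure.pi fun _ : Fin L => bernoulliGaussian p)
      = (∫⁻ ω, Y ω ∂Measure.pi fun _ : Fin L => bernoulliGaussian p) ^ M := by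
    rw [lintegral_pi_prod_eq_pow _ hYm, Fintype.card_fin]
  refine (measure_mono hsub).trans ((meas_ge_le_lintegral_div
    (Finset.measurable_fun_prod _ fun i _ => hYm.comp (measurable_pi_apply i)).aemeasurable
    (ENNReal.ofReal_pos.2 (Real.exp_pos _)).ne' ENNReal.ofReal_ne_top).trans ?_)
  simp only [Function.comp_apply]
  rw [hprod]
  have hY1 := lintegral_exp_neg_mul_abs_sum_le q hε.le hz1
  refine (ENNReal.div_le_div_right (pow_le_pow_left' hY1 M) _).trans ?_
  rw [← ENNReal.ofReal_pow (Real.exp_pos _).le, ← ENNReal.ofReal_div_of_pos (Real.exp_pos _),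
    ← Real.exp_nat_mul, ← Real.exp_sub]
  refine ENNReal.ofReal_le_ofReal ?_
  have hexp : M * -(p * (ε * Real.sqrt (2 / Real.pi) - ε ^ 2 / 2)) - -(ε * τ)
      = -(M * p * ε ^ 2) / 2 := by
    rw [hτ]; ring
  refine (Real.exp_le_exp.2 ?_).trans (le_mul_of_one_le_left (Real.exp_pos _).le one_le_two)
  refine hexp.trans_le ?_
  rw [neg_div, neg_div, neg_le_neg_iff]
  refine div_le_div_of_nonneg_left (by positivity) two_pos ?_
  linarith [mul_nonneg (Real.sqrt_nonneg 2) hε.le]
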